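/- arXiv:2012.13652 — 2 statements merged into one kernel-verified Lean document; each statement's English description precedes it below -/
import Mathlib

section
/- Every reduced spherical convex polygon on S^2 has thickness at most π/2. -/
open Set Metric
open scoped RealInnerProductSpace

noncomputable section

/-- Euclidean space `E^{d+1}`. -/
abbrev E (d : ℕ) := EuclideanSpace ℝ (Fin (d + 1))

/-- The unit sphere `S^d ⊆ E^{d+1}`. -/
def Sph (d : ℕ) : Set (E d) := Metric.sphere (0 : E d) 1

variable {d : ℕ}

/-- Geodesic (angular) distance on the unit sphere. -/
def sdist (x y : E d) : ℝ := Real.arccos ⟪x, y⟫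

/-- Closed hemisphere with center `p`. -/
def Hemi (p : E d) : Set (E d) := {x ∈ Sph d | 0 ≤ ⟪p, x⟫}

/-- Open hemisphere with center `p`. -/
def openHemi (p : E d) : Set (E d) := {x ∈ Sph d | 0 < ⟪p, x⟫}

/-- Boundary great subsphere of the hemisphere with center `p`. -/
def bdHemi (p : E d) : Set (E d) := {x ∈ Sph d | ⟪p, x⟫ = 0}

/-- Spherical convexity: no antipodal pairs, and the nonnegative cone over the
set is convex (equivalent to being closed under shorter arcs). -/
def SphConvex (C : Set (E d)) : Prop :=
  (∀ x ∈ C, -x ∉ C) ∧ Convex ℝ {v : E d | ∃ r : ℝ, 0 ≤ r ∧ ∃ x ∈ C, v = r • x}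

/-- Spherical convex hull: the smallest spherically convex subset of the
sphere containing `A`. -/
def sConvHull (A : Set (E d)) : Set (E d) := ⋂₀ {C | SphConvex C ∧ C ⊆ Sph d ∧ A ⊆ C}

/-- Interior of `C` relative to the sphere. -/
def sInterior (C : Set (E d)) : Set (E d) :=
  {x ∈ Sph d | ∃ ε > 0, Metric.ball x ε ∩ Sph d ⊆ C}

/-- A spherical convex body: closed, spherically convex, with nonempty
interior relative to the sphere. -/
def IsBody (C : Set (E d)) : Prop :=
  C ⊆ Sph d ∧ IsClosed C ∧ SphConvex C ∧ (sInterior C).Nonempty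

/-- Spherical ball of radius `r` centered at `p`. -/
def sBall (p : E d) (r : ℝ) : Set (E d) := {x ∈ Sph d | sdist p x ≤ r}

/-- Normalization of a vector. -/
def nrm (v : E d) : E d := ‖v‖⁻¹ • v

/-- The center of the `(d-1)`-dimensional hemisphere `bd(G) ∩ H`, where `G`, `H`
are the hemispheres centered at `g`, `h`. -/
def cGH (g h : E d) : E d := nrm (h - ⟪g, h⟫ • g)

/-- Thickness of the lune `Hemi g ∩ Hemi h`: the geodesic distance between the
centers of its two bounding `(d-1)`-dimensional hemispheres. -/
def lthick (g h : E d) : ℝ := Real.pi - sdist g h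

/-- The hemisphere centered at `k` supports `C`. -/
def Supports (k : E d) (C : Set (E d)) : Prop :=
  C ⊆ Hemi k ∧ (bdHemi k ∩ C).Nonempty

/-- Width of `C` determined by a supporting hemisphere centered at `k`:
minimal thickness of a lune `K ∩ K*` over supporting hemispheres `K* ≠ K`. -/
def width (C : Set (E d)) (k : E d) : ℝ :=
  sInf {w | ∃ k' ∈ Sph d, k' ≠ k ∧ k' ≠ -k ∧ Supports k' C ∧ w = lthick k k'}

/-- Thickness of `C`: minimal thickness of a lune containing `C`. -/
def thick (C : Set (E d)) : ℝ :=
  sInf {w | ∃ g ∈ Sph d, ∃ h ∈ Sph d, g ≠ h ∧ g ≠ -h ∧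
    C ⊆ Hemi g ∩ Hemi h ∧ w = lthick g h}

/-- Spherical diameter of a set. -/
def sdiam (C : Set (E d)) : ℝ := sSup {r | ∃ x ∈ C, ∃ y ∈ C, r = sdist x y}

/-- Reduced spherical convex body. -/
def Reduced (R : Set (E d)) : Prop :=
  IsBody R ∧ ∀ Z : Set (E d), IsBody Z → Z ⊆ R → Z ≠ R → thick Z < thick R

/-- Extreme point of a spherical convex body. -/
def ExtremePt (C : Set (E d)) (e : E d) : Prop := e ∈ C ∧ SphConvex (C \ {e})

/-- A spherically convex polygon on `S^2` with vertex set `vs`. -/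
def IsPolygon (vs : Finset (E 2)) (V : Set (E 2)) : Prop :=
  3 ≤ vs.card ∧ (∃ p ∈ Sph 2, ↑vs ⊆ openHemi p) ∧
  (∀ v ∈ vs, v ∉ sConvHull ((↑vs : Set (E 2)) \ {v})) ∧ V = sConvHull ↑vs

/-- Cone lemma: a functional positive on interior points. -/
lemma aux_interior_pos {V : Set (E d)} {x0 g : E d} (hx0 : x0 ∈ sInterior V)
    (hg : g ≠ 0) (hV : ∀ x ∈ V, 0 ≤ ⟪g, x⟫) : 0 < ⟪g, x0⟫ := by
  obtain ⟨hx, ε, hε, hsub⟩ := hx0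
  have hn : ‖x0‖ = 1 := by simpa [Sph] using hx
  have h0 : x0 ≠ 0 := by
    intro h; simp [h] at hn
  have hcont : ContinuousAt (fun t : ℝ => nrm (x0 - t • g)) 0 := by
    unfold nrm
    have h1 : ContinuousAt (fun t : ℝ => x0 - t • g) 0 := by fun_prop
    have h2 : ContinuousAt (fun t : ℝ => ‖x0 - t • g‖⁻¹) 0 := by
      apply ContinuousAt.inv₀
      · fun_prop
      · simp [h0]
    exact h2.smul h1
  have hval : nrm (x0 - (0:ℝ) • g) = x0 := by simp [nrm, hn]
  have hev : ∀ᶠ t in nhds (0:ℝ), nrm (x0 - t • g) ∈ Metric.ball x0 ε := by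
    apply hcont.eventually
    simp only [hval]
    exact Metric.ball_mem_nhds _ hε
  have hev2 : ∀ᶠ t in nhds (0:ℝ), x0 - t • g ≠ 0 := by
    have h1 : ContinuousAt (fun t : ℝ => x0 - t • g) 0 := by fun_prop
    exact h1.eventually_ne (by simpa using h0)
  obtain ⟨δ, hδ, hb⟩ := Metric.eventually_nhds_iff.mp (hev.and hev2)
  obtain ⟨h1, h2⟩ := hb (y := δ / 2) (by simp [abs_of_pos hδ]; linarith)
  have hmem : nrm (x0 - (δ/2) • g) ∈ V := by
    apply hsub
    refine ⟨h1, ?_⟩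
    simp [Sph, nrm, norm_smul, inv_mul_cancel₀ (norm_ne_zero_iff.mpr h2)]
  have h3 := hV _ hmem
  unfold nrm at h3
  rw [inner_smul_right, inner_sub_right, inner_smul_right, real_inner_self_eq_norm_sq] at h3
  have h4 : 0 < ‖x0 - (δ/2) • g‖⁻¹ := inv_pos.mpr (norm_pos_iff.mpr h2)
  have h5 := nonneg_of_mul_nonneg_right h3 h4
  have h6 : 0 < ‖g‖ := norm_pos_iff.mpr hg
  have : 0 < δ / 2 * ‖g‖^2 := by positivity
  linarith

/-- The polar of a slice. -/
lemma aux_polar {V : Set (E d)} (hV : SphConvex V) {m g x0 : E d} (hx0 : x0 ∈ V)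
    (hm0 : 0 < ⟪m, x0⟫) (hg : ∀ x ∈ V, 0 ≤ ⟪m, x⟫ → 0 ≤ ⟪g, x⟫) :
    ∃ t : ℝ, 0 ≤ t ∧ ∀ x ∈ V, 0 ≤ ⟪g - t • m, x⟫ := by
  set S : Set ℝ := {r | ∃ x ∈ V, 0 < ⟪m, x⟫ ∧ r = ⟪g, x⟫ / ⟪m, x⟫} with hS
  have hne : S.Nonempty := ⟨_, x0, hx0, hm0, rfl⟩
  have hlb : ∀ r ∈ S, 0 ≤ r := by
    rintro r ⟨x, hx, hmx, rfl⟩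
    exact div_nonneg (hg x hx hmx.le) hmx.le
  have hbdd : BddBelow S := ⟨0, hlb⟩
  refine ⟨sInf S, le_csInf hne hlb, ?_⟩
  intro x hx
  rw [inner_sub_left, real_inner_smul_left]
  rcases lt_trichotomy (⟪m, x⟫) 0 with h | h | h
  · have : ⟪g, x⟫ / ⟪m, x⟫ ≤ sInf S := by
      apply le_csInf hne
      rintro r ⟨y, hy, hmy, rfl⟩
      have hpos : 0 < ⟪m, y⟫ - ⟪m, x⟫ := by linarith
      have hxc : x ∈ {v : E d | ∃ r : ℝ, 0 ≤ r ∧ ∃ x ∈ V, v = r • x} :=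
        ⟨1, zero_le_one, x, hx, by simp⟩
      have hyc : y ∈ {v : E d | ∃ r : ℝ, 0 ≤ r ∧ ∃ x ∈ V, v = r • x} :=
        ⟨1, zero_le_one, y, hy, by simp⟩
      have ha1 : 0 ≤ ⟪m, y⟫ / (⟪m, y⟫ - ⟪m, x⟫) := div_nonneg hmy.le hpos.le
      have hb1 : 0 ≤ -⟪m, x⟫ / (⟪m, y⟫ - ⟪m, x⟫) := div_nonneg (by linarith) hpos.le
      have hc := convex_iff_add_mem.mp hV.2 hxc hyc ha1 hb1 (by field_simp; ring)
      obtain ⟨r, hr, w, hw, he⟩ := hc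
      have e1 : r * ⟪m, w⟫ = 0 := by
        rw [← inner_smul_right, ← he, inner_add_right, inner_smul_right, inner_smul_right]
        field_simp; ring
      have e2 : 0 ≤ r * ⟪g, w⟫ := by
        rcases mul_eq_zero.mp e1 with h' | h'
        · simp [h']
        · exact mul_nonneg hr (hg w hw h'.ge)
      rw [← inner_smul_right, ← he, inner_add_right, inner_smul_right, inner_smul_right] at e2
      have e3 : 0 ≤ ⟪m, y⟫ * ⟪g, x⟫ - ⟪m, x⟫ * ⟪g, y⟫ := by
        have := mul_nonneg hpos.le e2
        have e4 : (⟪m, y⟫ - ⟪m, x⟫) * (⟪m, y⟫ / (⟪m, y⟫ - ⟪m, x⟫) * ⟪g, x⟫ +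
            -⟪m, x⟫ / (⟪m, y⟫ - ⟪m, x⟫) * ⟪g, y⟫) =
            ⟪m, y⟫ * ⟪g, x⟫ - ⟪m, x⟫ * ⟪g, y⟫ := by
          have hne := hpos.ne'
          field_simp
          ring
        rw [← e4]
        exact this
      rw [div_le_iff_of_neg h, div_mul_eq_mul_div, div_le_iff₀ hmy]
      linarith
    rw [div_le_iff_of_neg h] at this
    linarith
  · rw [h]; simpa using hg x hx h.ge
  · have : sInf S ≤ ⟪g, x⟫ / ⟪m, x⟫ := csInf_le hbdd ⟨x, hx, h, rfl⟩
    rw [le_div_iff₀ h] at this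
    linarith

/-- A functional nonnegative on the vertices is nonnegative on the hull. -/
lemma aux_hull {A : Set (E d)} {p a : E d} (hA : A ⊆ openHemi p)
    (ha : ∀ x ∈ A, 0 ≤ ⟪a, x⟫) : ∀ x ∈ sConvHull A, 0 ≤ ⟪a, x⟫ := by
  intro x hx
  by_cases hAe : A.Nonempty
  swap
  · rw [not_nonempty_iff_eq_empty] at hAe
    have : x ∈ (∅ : Set (E d)) := by
      apply hx
      refine ⟨⟨by simp, by simpa using convex_empty⟩, by simp, by simp [hAe]⟩
    exact this.elim
  have : x ∈ {x ∈ Sph d | 0 ≤ ⟪a, x⟫ ∧ 0 < ⟪p, x⟫} := by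
    apply hx
    refine ⟨⟨?_, ?_⟩, fun y hy => hy.1, fun y hy => ⟨(hA hy).1, ha y hy, (hA hy).2⟩⟩
    · intro y hy hy'
      have h1 := hy.2.2
      have h2 := hy'.2.2
      rw [inner_neg_right] at h2
      linarith
    · obtain ⟨x1, hx1⟩ := hAe
      have key : {v : E d | ∃ r : ℝ, 0 ≤ r ∧ ∃ x ∈ {x ∈ Sph d | 0 ≤ ⟪a, x⟫ ∧ 0 < ⟪p, x⟫}, v = r • x}
          = {v : E d | v = 0 ∨ (0 ≤ ⟪a, v⟫ ∧ 0 < ⟪p, v⟫)} := by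
        ext v
        constructor
        · rintro ⟨r, hr, y, hy, rfl⟩
          rcases hr.eq_or_lt with h | h
          · left; simp [← h]
          · right
            rw [inner_smul_right, inner_smul_right]
            exact ⟨mul_nonneg hr hy.2.1, mul_pos h hy.2.2⟩
        · rintro (h | ⟨h1, h2⟩)
          · exact ⟨0, le_rfl, x1, ⟨(hA hx1).1, ha x1 hx1, (hA hx1).2⟩, by simp [h]⟩
          · have hv : v ≠ 0 := by rintro rfl; simp at h2
            have hn : 0 < ‖v‖ := norm_pos_iff.mpr hv
            refine ⟨‖v‖, hn.le, ‖v‖⁻¹ • v, ⟨?_, ?_, ?_⟩, ?_⟩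
            · simp [Sph, norm_smul, hn.ne']
            · rw [inner_smul_right]; positivity
            · rw [inner_smul_right]; positivity
            · rw [smul_smul, mul_inv_cancel₀ hn.ne', one_smul]
      rw [key]
      rintro v hv w hw α β hα hβ hαβ
      rcases hv with rfl | ⟨h1, h2⟩ <;> rcases hw with rfl | ⟨h3, h4⟩
      · left; simp
      · rcases hβ.eq_or_lt with h | h
        · left; simp [← h]
        · right; simp only [smul_zero, zero_add, inner_smul_right]
          exact ⟨by positivity, by positivity⟩
      · rcases hα.eq_or_lt with h | h
        · left; simp [← h]
        · right; simp only [smul_zero, add_zero, inner_smul_right]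
          exact ⟨by positivity, by positivity⟩
      · right; simp only [inner_add_right, inner_smul_right]
        refine ⟨by positivity, ?_⟩
        rcases hα.eq_or_lt with h | h
        · have : β = 1 := by linarith
          simpa [← h, this] using h4
        · have := mul_pos h h2
          have := mul_nonneg hβ h4.le
          linarith
  exact this.2.1

/-- A vertex has a supporting hemisphere strictly positive on the other vertices. -/
lemma aux_vertex {vs : Finset (E d)} {p v w0 : E d} (hA : ↑vs ⊆ openHemi p) (hv : v ∈ vs)
    (hw0 : w0 ∈ vs) (hne : w0 ≠ v) (hvx : v ∉ sConvHull ((↑vs : Set (E d)) \ {v})) :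
    ∃ q : E d, ⟪q, v⟫ = 0 ∧ ∀ w ∈ vs, w ≠ v → 0 < ⟪q, w⟫ := by
  have hpv : 0 < ⟪p, v⟫ := (hA hv).2
  have hvn : ‖v‖ = 1 := by simpa [Sph] using (hA hv).1
  obtain ⟨C, ⟨hC, hCS, hAC⟩, hvC⟩ : ∃ C, (SphConvex C ∧ C ⊆ Sph d ∧
      ((↑vs : Set (E d)) \ {v}) ⊆ C) ∧ v ∉ C := by
    simpa [sConvHull, and_assoc] using hvx
  set K := convexHull ℝ ((↑vs : Set (E d)) \ {v}) with hK
  have hKc : IsCompact K := (vs.finite_toSet.subset sdiff_subset).isCompact_convexHull (𝕜 := ℝ)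
  have hKp : K ⊆ {x | 0 < ⟪p, x⟫} := by
    apply convexHull_min
    · intro x hx; exact (hA hx.1).2
    · exact convex_halfSpace_gt ⟨fun x y => inner_add_right _ _ _,
        fun c x => inner_smul_right _ _ _⟩ 0
  have hKC : K ⊆ {v : E d | ∃ r : ℝ, 0 ≤ r ∧ ∃ x ∈ C, v = r • x} :=
    convexHull_min (fun x hx => ⟨1, zero_le_one, x, hAC hx, by simp⟩) hC.2
  set R : Set (E d) := (fun r : ℝ => r • v) '' Ici 0 with hR
  have hRc : IsClosed R := by
    have hv0 : v ≠ 0 := by intro h; simp [h] at hvn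
    exact (isClosedEmbedding_smul_left hv0).isClosedMap _ isClosed_Ici
  have hRconv : Convex ℝ R := by
    have := (convex_Ici (𝕜 := ℝ) (0:ℝ)).linear_image (LinearMap.toSpanSingleton ℝ (E d) v)
    exact this
  have hdisj : Disjoint K R := by
    rw [Set.disjoint_left]
    rintro x hx ⟨r, hr, rfl⟩
    have h1 : 0 < ⟪p, r • v⟫ := hKp hx
    rw [inner_smul_right] at h1
    have hr0 : 0 < r := by
      rcases (show (0:ℝ) ≤ r from hr).eq_or_lt with h | h
      · simp [← h] at h1
      · exact h
    obtain ⟨s, hs, y, hy, he⟩ := hKC hx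
    have hyn : ‖y‖ = 1 := by simpa [Sph] using hCS hy
    have hrs : r = s := by
      have := congrArg norm he
      simpa [norm_smul, hvn, hyn, abs_of_nonneg hs, abs_of_pos hr0] using this
    subst hrs
    have he' : r • v = r • y := he
    have : v = y := smul_right_injective _ hr0.ne' he'
    exact hvC (this ▸ hy)
  obtain ⟨f, s, t, h1, hst, h2⟩ :=
    geometric_hahn_banach_compact_closed (convex_convexHull ℝ _) hKc hRconv hRc hdisj
  have ht0 : t < 0 := by
    have := h2 0 ⟨0, by simp, by simp⟩
    simpa using this
  have hfv : 0 ≤ f v := by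
    by_contra hneg
    push Not at hneg
    have := h2 ((t / f v) • v) ⟨t / f v, div_nonneg_of_nonpos ht0.le hneg.le, rfl⟩
    rw [map_smul, smul_eq_mul, div_mul_cancel₀ _ hneg.ne] at this
    exact lt_irrefl _ this
  set u : E d := -(InnerProductSpace.toDual ℝ (E d)).symm f with hu
  have hui : ∀ x, ⟪u, x⟫ = - f x := by
    intro x; rw [hu, inner_neg_left, InnerProductSpace.toDual_symm_apply]
  refine ⟨u + (f v / ⟪p, v⟫) • p, ?_, ?_⟩
  · rw [inner_add_left, real_inner_smul_left, hui]
    field_simp; ring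
  · intro w hw hwv
    rw [inner_add_left, real_inner_smul_left, hui]
    have h3 := h1 w (subset_convexHull ℝ _ ⟨hw, hwv⟩)
    have h4 : 0 < ⟪p, w⟫ := (hA hw).2
    have : 0 ≤ f v / ⟪p, v⟫ * ⟪p, w⟫ := by positivity
    linarith

/-- A unit vector orthogonal to two given vectors. -/
lemma aux_orth (v q : E 2) : ∃ e : E 2, ‖e‖ = 1 ∧ ⟪v, e⟫ = 0 ∧ ⟪q, e⟫ = 0 := by
  classical
  set W : Submodule ℝ (E 2) := Submodule.span ℝ (({v, q} : Finset (E 2)) : Set (E 2)) with hW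
  have hfr : Module.finrank ℝ W ≤ 2 :=
    (finrank_span_finset_le_card _).trans Finset.card_le_two
  have hne : Wᗮ ≠ ⊥ := by
    intro h
    rw [Submodule.orthogonal_eq_bot_iff] at h
    rw [h, finrank_top] at hfr
    simp at hfr
  obtain ⟨e, he, he0⟩ := Submodule.exists_mem_ne_zero_of_ne_bot hne
  have hn : ‖e‖ ≠ 0 := norm_ne_zero_iff.mpr he0
  rw [Submodule.mem_orthogonal] at he
  refine ⟨‖e‖⁻¹ • e, by simp [norm_smul, hn], ?_, ?_⟩
  · rw [inner_smul_right, he v (Submodule.subset_span (by simp)), mul_zero]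
  · rw [inner_smul_right, he q (Submodule.subset_span (by simp)), mul_zero]

/-- every reduced spherical convex polygon has thickness at most
`π/2`. -/
theorem stmt13 (vs : Finset (E 2)) (V : Set (E 2)) (hpoly : IsPolygon vs V)
    (hbody : IsBody V) (hred : Reduced V) :
    thick V ≤ Real.pi / 2 := by
  by_contra hcon
  push Not at hcon
  obtain ⟨hcard, ⟨p, hp, hA⟩, hvert, hVdef⟩ := hpoly
  obtain ⟨hVS, hVcl, hVconv, x0, hx0⟩ := hbody
  have hx0V : x0 ∈ V := by
    obtain ⟨h, ε, hε, hs⟩ := hx0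
    exact hs ⟨Metric.mem_ball_self hε, h⟩
  have hVn : ∀ x ∈ V, ‖x‖ = 1 := fun x hx => by simpa [Sph] using hVS hx
  have hpi := Real.pi_pos
  -- the set of lunes
  have hlb : ∀ C : Set (E 2), BddBelow {w | ∃ g ∈ Sph 2, ∃ h ∈ Sph 2, g ≠ h ∧ g ≠ -h ∧
      C ⊆ Hemi g ∩ Hemi h ∧ w = lthick g h} := by
    intro C
    refine ⟨0, ?_⟩
    rintro w ⟨g, -, h, -, -, -, -, rfl⟩
    have := Real.arccos_le_pi ⟪g, h⟫
    simp only [lthick, sdist]; linarith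
  obtain ⟨w1, hw1⟩ : {w | ∃ g ∈ Sph 2, ∃ h ∈ Sph 2, g ≠ h ∧ g ≠ -h ∧
      V ⊆ Hemi g ∩ Hemi h ∧ w = lthick g h}.Nonempty := by
    by_contra hne
    rw [not_nonempty_iff_eq_empty] at hne
    unfold thick at hcon
    rw [hne, Real.sInf_empty] at hcon
    linarith
  have hthle : thick V ≤ Real.pi := by
    refine (csInf_le (hlb V) hw1).trans ?_
    obtain ⟨g, -, h, -, -, -, -, rfl⟩ := hw1
    have := Real.arccos_nonneg ⟪g, h⟫
    simp only [lthick, sdist]; linarith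
  set c := Real.cos (Real.pi - thick V) with hc
  have hc0 : 0 < c := Real.cos_pos_of_mem_Ioo ⟨by linarith, by linarith⟩
  have hc1 : c ≤ 1 := Real.cos_le_one _
  -- main inequality on the polar
  have hP : ∀ g h : E 2, (∀ x ∈ V, 0 ≤ ⟪g, x⟫) → (∀ x ∈ V, 0 ≤ ⟪h, x⟫) →
      c * ‖g‖ * ‖h‖ ≤ ⟪g, h⟫ := by
    have hunit : ∀ g h : E 2, ‖g‖ = 1 → ‖h‖ = 1 → (∀ x ∈ V, 0 ≤ ⟪g, x⟫) →
        (∀ x ∈ V, 0 ≤ ⟪h, x⟫) → c ≤ ⟪g, h⟫ := by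
      intro g h hg1 hh1 hg hh
      by_cases hgh : g = h
      · subst hgh; rw [real_inner_self_eq_norm_sq, hg1]; simpa using hc1
      by_cases hgh' : g = -h
      · have h1 := aux_interior_pos hx0 (by intro h; simp [h] at hg1) hg
        have h2 := hh x0 hx0V
        rw [hgh', inner_neg_left] at h1
        linarith
      have : thick V ≤ lthick g h := by
        apply csInf_le (hlb V)
        refine ⟨g, by simpa [Sph] using hg1, h, by simpa [Sph] using hh1, hgh, hgh', ?_, rfl⟩
        exact fun x hx => ⟨⟨hVS hx, hg x hx⟩, ⟨hVS hx, hh x hx⟩⟩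
      simp only [lthick, sdist] at this
      have habs := abs_real_inner_le_norm g h
      rw [hg1, hh1, mul_one, abs_le] at habs
      rw [← Real.cos_arccos habs.1 habs.2]
      apply Real.cos_le_cos_of_nonneg_of_le_pi (Real.arccos_nonneg _) <;> linarith
    intro g h hg hh
    by_cases hg0 : g = 0
    · simp [hg0]
    by_cases hh0 : h = 0
    · simp [hh0]
    have hgn := norm_pos_iff.mpr hg0
    have hhn := norm_pos_iff.mpr hh0
    have := hunit (‖g‖⁻¹ • g) (‖h‖⁻¹ • h) (by simp [norm_smul, hgn.ne'])
      (by simp [norm_smul, hhn.ne'])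
      (fun x hx => by
        rw [real_inner_smul_left]; exact mul_nonneg (inv_nonneg.mpr hgn.le) (hg x hx))
      (fun x hx => by
        rw [real_inner_smul_left]; exact mul_nonneg (inv_nonneg.mpr hhn.le) (hh x hx))
    rw [real_inner_smul_left, inner_smul_right] at this
    have h2 := mul_le_mul_of_nonneg_left this (mul_pos hgn hhn).le
    have h3 : ‖g‖ * ‖h‖ * (‖g‖⁻¹ * (‖h‖⁻¹ * ⟪g, h⟫)) = ⟪g, h⟫ := by
      field_simp
    rw [h3] at h2
    linarith
  -- pick a vertex
  obtain ⟨v, hv, w0, hw0, hvw⟩ := Finset.one_lt_card.mp (show 1 < vs.card by omega)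
  have hvV : v ∈ V := by
    rw [hVdef]; intro C hC; exact hC.2.2 hv
  have hvn := hVn v hvV
  obtain ⟨q, hqv, hqw, hqn⟩ : ∃ q : E 2, ⟪q, v⟫ = 0 ∧ (∀ w ∈ vs, w ≠ v → 0 < ⟪q, w⟫) ∧
      ‖q‖ = 1 := by
    obtain ⟨q, h1, h2⟩ := aux_vertex hA hv hw0 hvw.symm (hvert v hv)
    have hq0 : q ≠ 0 := by
      rintro rfl
      have := h2 w0 hw0 hvw.symm
      simp at this
    have hqn := norm_pos_iff.mpr hq0
    refine ⟨‖q‖⁻¹ • q, by rw [real_inner_smul_left, h1, mul_zero], ?_, ?_⟩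
    · intro w hw hwv
      rw [real_inner_smul_left]
      exact mul_pos (inv_pos.mpr hqn) (h2 w hw hwv)
    · simp [norm_smul, hqn.ne']
  obtain ⟨e, hen, hve, hqe⟩ := aux_orth v q
  have hwn : ∀ w ∈ vs, ‖w‖ = 1 := fun w hw => by simpa [Sph] using (hA hw).1
  -- uniform ε
  obtain ⟨ε, hε, hεw⟩ : ∃ ε > 0, ∀ w ∈ vs, w ≠ v → ε ≤ ⟪q, w⟫ := by
    have hne : (vs.erase v).Nonempty := ⟨w0, by simp [hvw.symm, hw0]⟩
    obtain ⟨w1, hw1, hmin⟩ := Finset.exists_min_image (vs.erase v) (fun w => ⟪q, w⟫) hne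
    rw [Finset.mem_erase] at hw1
    exact ⟨_, hqw w1 hw1.2 hw1.1, fun w hw hwv => hmin w (by simp [hw, hwv])⟩
  have hab : ∀ σ : ℝ, |σ| ≤ ε → ∀ x ∈ V, 0 ≤ ⟪q + σ • e, x⟫ := by
    intro σ hσ
    rw [hVdef]
    apply aux_hull hA
    intro w hw
    rw [inner_add_left, real_inner_smul_left]
    by_cases hwv : w = v
    · rw [hwv, hqv, real_inner_comm, hve]; simp
    · have h1 := hεw w hw hwv
      have h2 := abs_real_inner_le_norm e w
      rw [hen, hwn w hw, mul_one] at h2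
      have h3 : |σ * ⟪e, w⟫| ≤ ε := by
        rw [abs_mul]
        calc |σ| * |⟪e, w⟫| ≤ ε * 1 := by gcongr
          _ = ε := mul_one _
      have := (abs_le.mp h3).1
      linarith
  set s := Real.sqrt (1 + ε^2) with hs
  have hs1 : 1 < s := by
    rw [hs, Real.lt_sqrt (by norm_num)]
    have : 0 < ε^2 := by positivity
    linarith
  have hnab : ∀ σ : ℝ, σ^2 = ε^2 → ‖q + σ • e‖ = s := by
    intro σ hσ
    have hin : ‖q + σ • e‖^2 = 1 + ε^2 := by
      rw [norm_add_sq_real, inner_smul_right, hqe, norm_smul, hqn, hen, mul_one]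
      simp [hσ]
    rw [hs, ← hin, Real.sqrt_sq (norm_nonneg _)]
  have hxq : ∀ x : E 2, (∀ y ∈ V, 0 ≤ ⟪x, y⟫) → c * s * ‖x‖ ≤ ⟪x, q⟫ := by
    intro x hx
    have h1 := hP x _ hx (hab ε (by rw [abs_of_pos hε]))
    have h2 := hP x _ hx (hab (-ε) (by rw [abs_neg, abs_of_pos hε]))
    rw [hnab _ rfl, inner_add_right, inner_smul_right] at h1
    rw [hnab _ (by ring), inner_add_right, inner_smul_right] at h2
    linarith
  have hqV : ∀ x ∈ V, 0 ≤ ⟪q, x⟫ := by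
    simpa using hab 0 (by simpa using hε.le)
  have hqx0 : 0 < ⟪q, x0⟫ := aux_interior_pos hx0 (by intro h; simp [h] at hqn) hqV
  obtain ⟨η, hη, hη1, hη2⟩ : ∃ η > 0, η * (1 + c) ≤ c * (s - 1) ∧ η < ⟪q, x0⟫ := by
    refine ⟨min (c * (s-1) / (1 + c)) (⟪q, x0⟫ / 2), ?_, ?_, ?_⟩
    · have : 0 < s - 1 := by linarith
      apply lt_min <;> positivity
    · rw [← le_div_iff₀ (by linarith)]; exact min_le_left _ _
    · exact (min_le_right _ _).trans_lt (by linarith)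
  set m := q - η • v with hm
  have hmn : ‖m‖ ≤ 1 + η := by
    refine (norm_sub_le _ _).trans ?_
    rw [hqn, norm_smul, hvn, Real.norm_eq_abs, abs_of_pos hη, mul_one]
  have hmx0 : 0 < ⟪m, x0⟫ := by
    rw [hm, inner_sub_left, real_inner_smul_left]
    have h2 := real_inner_le_norm v x0
    rw [hvn, hVn x0 hx0V, mul_one] at h2
    nlinarith
  have hmv : ⟪m, v⟫ < 0 := by
    rw [hm, inner_sub_left, real_inner_smul_left, hqv, real_inner_self_eq_norm_sq, hvn]
    linarith
  have hxm : ∀ x : E 2, (∀ y ∈ V, 0 ≤ ⟪x, y⟫) → c * ‖x‖ * ‖m‖ ≤ ⟪x, m⟫ := by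
    intro x hx
    have h1 := hxq x hx
    have h2 := real_inner_le_norm x v
    rw [hvn, mul_one] at h2
    rw [hm, inner_sub_right, inner_smul_right, ← hm]
    have h3 := norm_nonneg x
    have h4 : c * ‖x‖ * ‖m‖ ≤ c * ‖x‖ * (1 + η) := by gcongr
    have h5 : η * ⟪x, v⟫ ≤ η * ‖x‖ := by gcongr
    have h6 := mul_le_mul_of_nonneg_right hη1 h3
    nlinarith
  -- the smaller body
  set Z : Set (E 2) := {x ∈ V | 0 ≤ ⟪m, x⟫} with hZ
  have hx0Z : x0 ∈ Z := ⟨hx0V, hmx0.le⟩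
  have hZV : Z ⊆ V := fun x hx => hx.1
  have hZbody : IsBody Z := by
    refine ⟨hZV.trans hVS, ?_, ⟨?_, ?_⟩, x0, hVS hx0V, ?_⟩
    · exact hVcl.inter (isClosed_le (f := fun _ : E 2 => (0:ℝ)) (g := fun x : E 2 => ⟪m, x⟫)
        continuous_const (by fun_prop))
    · exact fun x hx hx' => hVconv.1 x hx.1 hx'.1
    · have key : {v : E 2 | ∃ r : ℝ, 0 ≤ r ∧ ∃ x ∈ Z, v = r • x} =
          {v : E 2 | ∃ r : ℝ, 0 ≤ r ∧ ∃ x ∈ V, v = r • x} ∩ {v | 0 ≤ ⟪m, v⟫} := by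
        ext y
        constructor
        · rintro ⟨r, hr, x, hx, rfl⟩
          refine ⟨⟨r, hr, x, hx.1, rfl⟩, ?_⟩
          simp only [mem_ofPred_eq, inner_smul_right]
          exact mul_nonneg hr hx.2
        · rintro ⟨⟨r, hr, x, hx, rfl⟩, h2⟩
          simp only [mem_ofPred_eq, inner_smul_right] at h2
          rcases hr.eq_or_lt with h | h
          · exact ⟨0, le_rfl, x0, hx0Z, by simp [← h]⟩
          · exact ⟨r, hr, x, ⟨hx, nonneg_of_mul_nonneg_right h2 h⟩, rfl⟩
      rw [key]
      exact hVconv.2.inter (convex_halfSpace_ge ⟨fun x y => inner_add_right _ _ _,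
        fun c x => inner_smul_right _ _ _⟩ 0)
    · obtain ⟨_, ε1, hε1, hs1⟩ := hx0
      have hop : IsOpen {x : E 2 | 0 < ⟪m, x⟫} := isOpen_lt continuous_const (by fun_prop)
      obtain ⟨ε2, hε2, hs2⟩ := Metric.isOpen_iff.mp hop x0 hmx0
      refine ⟨min ε1 ε2, lt_min hε1 hε2, ?_⟩
      rintro x ⟨hx, hxS⟩
      refine ⟨hs1 ⟨Metric.ball_subset_ball (min_le_left _ _) hx, hxS⟩, ?_⟩
      exact le_of_lt (hs2 (Metric.ball_subset_ball (min_le_right _ _) hx))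
  have hZne : Z ≠ V := by
    intro h
    have : v ∈ Z := h ▸ hvV
    exact absurd this.2 (not_le.mpr hmv)
  have hlt := hred.2 Z hZbody hZV hZne
  refine absurd hlt (not_lt.mpr ?_)
  show thick V ≤ sInf _
  apply le_csInf
  · obtain ⟨g, hg, h, hh, h1, h2, h3, h4⟩ := hw1
    exact ⟨w1, g, hg, h, hh, h1, h2, hZV.trans h3, h4⟩
  · rintro w ⟨g, hg, h, hh, -, -, hsub, rfl⟩
    have hg1 : ‖g‖ = 1 := by simpa [Sph] using hg
    have hh1 : ‖h‖ = 1 := by simpa [Sph] using hh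
    obtain ⟨t, ht, hk⟩ := aux_polar hVconv hx0V hmx0 (g := g)
      (fun x hx hmx => (hsub ⟨hx, hmx⟩).1.2)
    obtain ⟨t', ht', hk'⟩ := aux_polar hVconv hx0V hmx0 (g := h)
      (fun x hx hmx => (hsub ⟨hx, hmx⟩).2.2)
    set k := g - t • m with hkdef
    set k' := h - t' • m with hkdef'
    have eg : g = k + t • m := by rw [hkdef]; abel
    have eh : h = k' + t' • m := by rw [hkdef']; abel
    have n1 : 1 ≤ ‖k‖ + t * ‖m‖ := by
      rw [← hg1, eg]
      refine (norm_add_le _ _).trans ?_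
      rw [norm_smul, Real.norm_eq_abs, abs_of_nonneg ht]
    have n2 : 1 ≤ ‖k'‖ + t' * ‖m‖ := by
      rw [← hh1, eh]
      refine (norm_add_le _ _).trans ?_
      rw [norm_smul, Real.norm_eq_abs, abs_of_nonneg ht']
    have hcgh : c ≤ ⟪g, h⟫ := by
      have i1 := hP k k' hk hk'
      have i2 := mul_le_mul_of_nonneg_left (hxm k hk) ht'
      have i3 := mul_le_mul_of_nonneg_left (hxm k' hk') ht
      have i4 : c * ‖m‖^2 ≤ ‖m‖^2 := by nlinarith [sq_nonneg ‖m‖]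
      have i5 := mul_le_mul_of_nonneg_left i4 (mul_nonneg ht ht')
      have e1 : ⟪g, h⟫ = ⟪k, k'⟫ + t' * ⟪k, m⟫ + t * ⟪k', m⟫ + t * t' * ‖m‖^2 := by
        rw [eg, eh, inner_add_left, inner_add_right, inner_add_right, real_inner_smul_left,
          real_inner_smul_left, inner_smul_right, inner_smul_right,
          real_inner_self_eq_norm_sq, real_inner_comm k' m]
        ring
      have i6 : c * 1 ≤ c * ((‖k‖ + t * ‖m‖) * (‖k'‖ + t' * ‖m‖)) := by
        apply mul_le_mul_of_nonneg_left _ hc0.le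
        nlinarith
      rw [e1]
      linarith
    have := Real.arccos_le_arccos hcgh
    rw [hc, Real.arccos_cos (by linarith) (by linarith)] at this
    simp only [lthick, sdist]
    linarith
end
end

section
/- A convex body of diameter δ (with 0 < δ < π/2) on S^d is complete (i.e., maximal with respect to inclusion among subsets of a hemisphere having diameter δ) if and only if it is a body of constant width δ. Moreover, every complete set of diameter δ on S^d equals the intersection of all balls of radius δ centered at its points, and hence is a convex body. -/
open Set Metric
open scoped RealInnerProductSpace

noncomputable section

variable {d : ℕ}

/-- A complete set of diameter `δ` on the sphere: a subset of a hemisphere of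
diameter `δ` which is maximal with respect to inclusion among such sets. -/
def CompleteBody {d : ℕ} (D : Set (E d)) (δ : ℝ) : Prop :=
  (∃ p ∈ Sph d, D ⊆ Hemi p) ∧ sdiam D = δ ∧
  ∀ x ∈ Sph d, x ∉ D → δ < sdiam (insert x D)

lemma sph_norm {x : E d} (hx : x ∈ Sph d) : ‖x‖ = 1 := by
  simpa [Sph] using hx

lemma sph_of_norm {x : E d} (hx : ‖x‖ = 1) : x ∈ Sph d := by
  simpa [Sph] using hx

lemma inner_self_one {x : E d} (hx : ‖x‖ = 1) : ⟪x, x⟫ = (1 : ℝ) := by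
  rw [real_inner_self_eq_norm_sq, hx]; norm_num

lemma sph_of_inner {x : E d} (hx : ⟪x, x⟫ = (1 : ℝ)) : x ∈ Sph d := by
  apply sph_of_norm
  rw [real_inner_self_eq_norm_sq] at hx
  have := norm_nonneg x
  nlinarith

lemma inner_le_one' {x y : E d} (hx : ‖x‖ = 1) (hy : ‖y‖ = 1) : ⟪x, y⟫ ≤ (1 : ℝ) := by
  have := real_inner_le_norm x y
  rw [hx, hy] at this; linarith

lemma neg_one_le_inner' {x y : E d} (hx : ‖x‖ = 1) (hy : ‖y‖ = 1) : (-1 : ℝ) ≤ ⟪x, y⟫ := by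
  have := neg_le_of_abs_le (abs_real_inner_le_norm x y)
  rw [hx, hy] at this; linarith

/-- A Bessel inequality for two orthogonal unit vectors. -/
lemma bessel2 {x k t : E d} (hx : ‖x‖ = 1) (hk : ‖k‖ = 1) (ht : ‖t‖ = 1)
    (h : ⟪k, t⟫ = (0 : ℝ)) : ⟪x, t⟫ ^ 2 + ⟪x, k⟫ ^ 2 ≤ (1 : ℝ) := by
  have h2 : (0 : ℝ) ≤ ⟪x - ⟪x, t⟫ • t - ⟪x, k⟫ • k, x - ⟪x, t⟫ • t - ⟪x, k⟫ • k⟫ :=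
    real_inner_self_nonneg
  have h' : ⟪t, k⟫ = (0 : ℝ) := by rw [real_inner_comm]; exact h
  simp only [inner_sub_left, inner_sub_right, inner_smul_left, inner_smul_right, h, h',
    inner_self_one hx, inner_self_one hk, inner_self_one ht, real_inner_comm x t,
    real_inner_comm x k] at h2
  simp at h2
  nlinarith

lemma sdist_le_iff {x y : E d} (hx : ‖x‖ = 1) (hy : ‖y‖ = 1) {δ : ℝ} (h0 : 0 ≤ δ)
    (h1 : δ ≤ Real.pi) : sdist x y ≤ δ ↔ Real.cos δ ≤ ⟪x, y⟫ := by
  unfold sdist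
  constructor
  · intro h
    have := Real.cos_le_cos_of_nonneg_of_le_pi (Real.arccos_nonneg _) h1 h
    rwa [Real.cos_arccos (neg_one_le_inner' hx hy) (inner_le_one' hx hy)] at this
  · intro h
    have := Real.arccos_le_arccos h
    rwa [Real.arccos_cos h0 h1] at this

lemma sdiam_bdd (A : Set (E d)) : BddAbove {r | ∃ x ∈ A, ∃ y ∈ A, r = sdist x y} := by
  refine ⟨Real.pi, ?_⟩
  rintro r ⟨x, _, y, _, rfl⟩
  exact Real.arccos_le_pi _

lemma sdiam_le_iff {A : Set (E d)} (hA : A ⊆ Sph d) {δ : ℝ} (h0 : 0 ≤ δ)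
    (h1 : δ ≤ Real.pi) :
    sdiam A ≤ δ ↔ ∀ x ∈ A, ∀ y ∈ A, Real.cos δ ≤ ⟪x, y⟫ := by
  constructor
  · intro h x hx y hy
    rw [← sdist_le_iff (sph_norm (hA hx)) (sph_norm (hA hy)) h0 h1]
    exact (le_csSup (sdiam_bdd A) ⟨x, hx, y, hy, rfl⟩).trans h
  · intro h
    apply Real.sSup_le _ h0
    rintro r ⟨x, hx, y, hy, rfl⟩
    rw [sdist_le_iff (sph_norm (hA hx)) (sph_norm (hA hy)) h0 h1]
    exact h x hx y hy

lemma complete_mem {D : Set (E d)} (hD : D ⊆ Sph d) {δ : ℝ} (h0 : 0 ≤ δ)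
    (h1 : δ ≤ Real.pi) (h : CompleteBody D δ) {x : E d} (hx : ‖x‖ = 1)
    (hp : ∀ p ∈ D, Real.cos δ ≤ ⟪p, x⟫) : x ∈ D := by
  by_contra hxD
  have h3 := h.2.2 x (sph_of_norm hx) hxD
  have h4 := (sdiam_le_iff hD h0 h1).1 h.2.1.le
  apply absurd h3; rw [not_lt]
  rw [sdiam_le_iff (insert_subset (sph_of_norm hx) hD) h0 h1]
  rintro y (rfl | hy) z (rfl | hz)
  · rw [inner_self_one hx]; exact Real.cos_le_one _
  · rw [real_inner_comm]; exact hp z hz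
  · exact hp y hy
  · exact h4 y hy z hz

lemma part2 {D : Set (E d)} (hD : D ⊆ Sph d) {δ : ℝ} (h0 : 0 < δ)
    (h1 : δ < Real.pi / 2) (h : CompleteBody D δ) :
    D = {x ∈ Sph d | ∀ p ∈ D, sdist p x ≤ δ} ∧ IsBody D := by
  have hpi : δ ≤ Real.pi := by linarith [Real.pi_pos]
  have hc : 0 < Real.cos δ := Real.cos_pos_of_mem_Ioo ⟨by linarith, h1⟩
  have h4 := (sdiam_le_iff hD h0.le hpi).1 h.2.1.le
  have hmem : ∀ x, ‖x‖ = 1 → (∀ p ∈ D, Real.cos δ ≤ ⟪p, x⟫) → x ∈ D :=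
    fun x hx hp => complete_mem hD h0.le hpi h hx hp
  -- two distinct points
  obtain ⟨a, ha, b, hb, hab⟩ : ∃ a ∈ D, ∃ b ∈ D, a ≠ b := by
    by_contra hcon
    push Not at hcon
    have : sdiam D ≤ 0 := by
      rw [sdiam_le_iff hD le_rfl Real.pi_pos.le]
      intro x hx y hy
      rw [hcon x hx y hy, Real.cos_zero, inner_self_one (sph_norm (hD hy))]
    rw [h.2.1] at this; linarith
  have hset : D = {x ∈ Sph d | ∀ p ∈ D, Real.cos δ ≤ ⟪p, x⟫} := by
    ext x
    exact ⟨fun hx => ⟨hD hx, fun p hp => h4 p hp x hx⟩, fun hx => hmem x (sph_norm hx.1) hx.2⟩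
  refine ⟨?_, hD, ?_, ⟨?_, ?_⟩, ?_⟩
  · ext x
    constructor
    · intro hx
      exact ⟨hD hx, fun p hp => (sdist_le_iff (sph_norm (hD hp)) (sph_norm (hD hx)) h0.le hpi).2
        (h4 p hp x hx)⟩
    · intro hx
      exact hmem x (sph_norm hx.1) fun p hp =>
        (sdist_le_iff (sph_norm (hD hp)) (sph_norm hx.1) h0.le hpi).1 (hx.2 p hp)
  · have : D = Sph d ∩ ⋂ p ∈ D, {x : E d | Real.cos δ ≤ ⟪p, x⟫} := by
      conv_lhs => rw [hset]
      ext x; simp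
    rw [this]
    refine Metric.isClosed_sphere.inter (isClosed_biInter fun p _ => ?_)
    exact isClosed_le continuous_const (by fun_prop)
  · intro x hx hx'
    have h5 := h4 a ha x hx
    have h6 := h4 a ha _ hx'
    rw [inner_neg_right] at h6
    linarith
  · have : {v : E d | ∃ r : ℝ, 0 ≤ r ∧ ∃ x ∈ D, v = r • x}
        = {v : E d | ∀ p ∈ D, Real.cos δ * ‖v‖ ≤ ⟪p, v⟫} := by
      ext v
      constructor
      · rintro ⟨r, hr, x, hx, rfl⟩ p hp
        rw [norm_smul, inner_smul_right, sph_norm (hD hx), Real.norm_of_nonneg hr]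
        have := mul_le_mul_of_nonneg_left (h4 p hp x hx) hr
        linarith
      · intro hv
        by_cases hv0 : v = 0
        · exact ⟨0, le_rfl, a, ha, by simp [hv0]⟩
        · have hn : 0 < ‖v‖ := norm_pos_iff.2 hv0
          refine ⟨‖v‖, hn.le, ‖v‖⁻¹ • v, hmem _ ?_ ?_, ?_⟩
          · rw [norm_smul, norm_inv, norm_norm, inv_mul_cancel₀ hn.ne']
          · intro p hp
            rw [inner_smul_right, ← div_eq_inv_mul, le_div_iff₀ hn]
            exact hv p hp
          · rw [smul_smul, mul_inv_cancel₀ hn.ne', one_smul]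
    rw [this]
    intro u hu v hv s t hs ht _ p hp
    have h5 := mul_le_mul_of_nonneg_left (hu p hp) hs
    have h6 := mul_le_mul_of_nonneg_left (hv p hp) ht
    have h7 : ‖s • u + t • v‖ ≤ s * ‖u‖ + t * ‖v‖ := by
      refine (norm_add_le _ _).trans ?_
      rw [norm_smul, norm_smul, Real.norm_of_nonneg hs, Real.norm_of_nonneg ht]
    have h8 := mul_le_mul_of_nonneg_left h7 hc.le
    rw [inner_add_right, inner_smul_right, inner_smul_right]
    linarith
  · have han := sph_norm (hD ha)
    have hbn := sph_norm (hD hb)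
    have hlt : ⟪a, b⟫ < (1 : ℝ) := by
      refine lt_of_le_of_ne (inner_le_one' han hbn) fun he => hab ?_
      exact (inner_eq_one_iff_of_norm_eq_one han hbn).1 he
    have hn2 : ‖a + b‖ ^ 2 = 2 + 2 * ⟪a, b⟫ := by
      rw [norm_add_sq_real, han, hbn]; ring
    have hn0 : 0 < ‖a + b‖ := by
      have := h4 a ha b hb
      refine lt_of_le_of_ne (norm_nonneg _) fun he => ?_
      rw [← he] at hn2; nlinarith
    have hn3 : ‖a + b‖ < 2 := by nlinarith
    have hmn : ‖‖a + b‖⁻¹ • (a + b)‖ = 1 := by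
      rw [norm_smul, norm_inv, norm_norm, inv_mul_cancel₀ hn0.ne']
    have hε : 0 < 2 * Real.cos δ / ‖a + b‖ - Real.cos δ := by
      rw [sub_pos, lt_div_iff₀ hn0]; nlinarith
    refine ⟨‖a + b‖⁻¹ • (a + b), sph_of_norm hmn, _, hε, ?_⟩
    rintro x ⟨hx, hxs⟩
    refine hmem x (sph_norm hxs) fun p hp => ?_
    have hpn := sph_norm (hD hp)
    have h5 : 2 * Real.cos δ / ‖a + b‖ ≤ ⟪p, ‖a + b‖⁻¹ • (a + b)⟫ := by
      rw [inner_smul_right, ← div_eq_inv_mul, inner_add_right]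
      gcongr
      linarith [h4 p hp a ha, h4 p hp b hb]
    rw [mem_ball, dist_eq_norm] at hx
    have h6 := neg_le_of_abs_le (abs_real_inner_le_norm p (x - ‖a + b‖⁻¹ • (a + b)))
    rw [hpn, one_mul, inner_sub_right] at h6
    linarith

/-- First-order optimality for the nearest point. -/
lemma first_order {C : Set (E d)} (hC : C ⊆ Sph d) (hcv : SphConvex C) {v y0 : E d}
    (hy0 : y0 ∈ C) (hm : 0 ≤ ⟪v, y0⟫) (hmax : ∀ y ∈ C, ⟪v, y⟫ ≤ ⟪v, y0⟫) {y : E d}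
    (hy : y ∈ C) : ⟪v, y⟫ ≤ ⟪v, y0⟫ * ⟪y0, y⟫ := by
  have hy0n := sph_norm (hC hy0)
  have hyn := sph_norm (hC hy)
  have key : ∀ ε : ℝ, 0 < ε → ⟪v, y⟫ ≤ ⟪v, y0⟫ * ⟪y0, y⟫ + ε * (⟪v, y0⟫ / 2) := by
    intro ε hε
    have h1 : y0 ∈ {v : E d | ∃ r : ℝ, 0 ≤ r ∧ ∃ x ∈ C, v = r • x} :=
      ⟨1, zero_le_one, y0, hy0, by simp⟩
    have h2 : y ∈ {v : E d | ∃ r : ℝ, 0 ≤ r ∧ ∃ x ∈ C, v = r • x} :=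
      ⟨1, zero_le_one, y, hy, by simp⟩
    have hcv2 := hcv.2
    have ha1 : 0 ≤ 1 / (1 + ε) := by positivity
    have hb1 : 0 ≤ ε / (1 + ε) := by positivity
    have h3 := hcv2 h1 h2 ha1 hb1 (by field_simp)
    obtain ⟨r, hr, z, hz, hrz⟩ := h3
    have hw : y0 + ε • y = ((1 + ε) * r) • z := by
      rw [mul_smul, ← hrz, smul_add, smul_smul, smul_smul]
      congr 1
      · rw [mul_one_div_cancel (by positivity), one_smul]
      · congr 1; field_simp
    set R := (1 + ε) * r
    have hR : 0 ≤ R := by positivity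
    have hzn := sph_norm (hC hz)
    have e1 : ⟪v, y0⟫ + ε * ⟪v, y⟫ = R * ⟪v, z⟫ := by
      rw [← inner_smul_right, ← inner_smul_right, ← hw, inner_add_right]
    have e2 : R ^ 2 = 1 + 2 * ε * ⟪y0, y⟫ + ε ^ 2 := by
      have : ‖y0 + ε • y‖ ^ 2 = R ^ 2 := by
        rw [hw, norm_smul, hzn, Real.norm_of_nonneg hR, mul_one]
      rw [← this, norm_add_sq_real, norm_smul, hy0n, hyn, inner_smul_right,
        Real.norm_of_nonneg hε.le]
      ring
    have e3 : R ≤ 1 + ε * ⟪y0, y⟫ + ε ^ 2 / 2 := by nlinarith [sq_nonneg (R - 1)]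
    have e4 : R * ⟪v, z⟫ ≤ (1 + ε * ⟪y0, y⟫ + ε ^ 2 / 2) * ⟪v, y0⟫ :=
      (mul_le_mul_of_nonneg_left (hmax z hz) hR).trans (mul_le_mul_of_nonneg_right e3 hm)
    have e5 : ε * ⟪v, y⟫ ≤ ε * (⟪v, y0⟫ * ⟪y0, y⟫ + ε * (⟪v, y0⟫ / 2)) := by
      rw [← e1] at e4
      linarith
    exact le_of_mul_le_mul_left e5 hε
  have hm1 : 0 < ⟪v, y0⟫ / 2 + 1 := by linarith
  apply le_of_forall_pos_le_add
  intro η hη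
  refine (key (η / (⟪v, y0⟫ / 2 + 1)) (by positivity)).trans ?_
  gcongr
  rw [div_mul_eq_mul_div, div_le_iff₀ hm1]
  nlinarith

/-- The hemisphere produced by the first-order condition at a maximizer. -/
lemma support_of_max {C : Set (E d)} (hC : C ⊆ Sph d) (hcv : SphConvex C) {v y0 : E d}
    (hv : ‖v‖ = 1) (hy0 : y0 ∈ C) (hm : 0 ≤ ⟪v, y0⟫) (hm1 : ⟪v, y0⟫ < (1 : ℝ))
    (hmax : ∀ y ∈ C, ⟪v, y⟫ ≤ ⟪v, y0⟫) :
    ∃ k ∈ Sph d, Supports k C ∧ ⟪k, y0⟫ = (0 : ℝ) ∧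
      v = ⟪v, y0⟫ • y0 - √(1 - ⟪v, y0⟫ ^ 2) • k := by
  set m : ℝ := ⟪v, y0⟫ with hmdef
  have hpos : 0 < 1 - m ^ 2 := by nlinarith
  set q := √(1 - m ^ 2) with hq
  have hqpos : 0 < q := Real.sqrt_pos.2 hpos
  have hq2 : q ^ 2 = 1 - m ^ 2 := Real.sq_sqrt hpos.le
  have hy0n := sph_norm (hC hy0)
  have hk0 : ⟪q⁻¹ • (m • y0 - v), y0⟫ = (0 : ℝ) := by
    rw [real_inner_smul_left, inner_sub_left, real_inner_smul_left, inner_self_one hy0n, ← hmdef]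
    ring
  have hks : q⁻¹ • (m • y0 - v) ∈ Sph d := by
    apply sph_of_inner
    rw [real_inner_smul_left, real_inner_smul_right, inner_sub_left, inner_sub_right,
      inner_sub_right, real_inner_smul_left, real_inner_smul_left, real_inner_smul_right,
      real_inner_smul_right, inner_self_one hy0n, inner_self_one hv, real_inner_comm v y0, ← hmdef]
    field_simp
    linarith
  refine ⟨q⁻¹ • (m • y0 - v), hks, ⟨?_, y0, ⟨hC hy0, hk0⟩, hy0⟩, hk0, ?_⟩
  · intro y hy
    refine ⟨hC hy, ?_⟩
    rw [real_inner_smul_left, inner_sub_left, real_inner_smul_left]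
    have := first_order hC hcv hy0 hm hmax hy
    have h2 : 0 ≤ m * ⟪y0, y⟫ - ⟪v, y⟫ := by linarith
    positivity
  · rw [smul_smul, mul_inv_cancel₀ hqpos.ne', one_smul]; abel

lemma width_bdd (C : Set (E d)) (k : E d) :
    BddBelow {w | ∃ k' ∈ Sph d, k' ≠ k ∧ k' ≠ -k ∧ Supports k' C ∧ w = lthick k k'} := by
  refine ⟨0, ?_⟩
  rintro w ⟨k', _, _, _, _, rfl⟩
  have := Real.arccos_le_pi ⟪k, k'⟫
  simp only [lthick, sdist]; linarith

/-- Reaching depth `δ`: constant width gives a point deep inside the hemisphere. -/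
lemma deep_point {C : Set (E d)} (hC : IsBody C) {δ : ℝ} (h0 : 0 < δ)
    (h1 : δ < Real.pi / 2) (hdiam : ∀ x ∈ C, ∀ y ∈ C, Real.cos δ ≤ ⟪x, y⟫)
    {k : E d} (hk : k ∈ Sph d) (hs : Supports k C) (hw : δ ≤ width C k) :
    ∃ q ∈ C, Real.sin δ ≤ ⟪k, q⟫ := by
  obtain ⟨hCS, hcl, hcv, hint⟩ := hC
  have hc : 0 < Real.cos δ := Real.cos_pos_of_mem_Ioo ⟨by linarith, h1⟩
  have hs0 : 0 < Real.sin δ := Real.sin_pos_of_pos_of_lt_pi h0 (by linarith [Real.pi_pos])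
  have hcs := Real.sin_sq_add_cos_sq δ
  have hkn := sph_norm hk
  have hcomp : IsCompact C := (isCompact_sphere (0 : E d) 1).of_isClosed_subset hcl hCS
  obtain ⟨hsub, t, ⟨_, hkt⟩, ht⟩ := hs
  obtain ⟨y0, hy0, hmax⟩ := hcomp.exists_isMaxOn ⟨t, ht⟩
    (f := fun y => (⟪k, y⟫ : ℝ)) (by fun_prop)
  have hmax' : ∀ y ∈ C, ⟪k, y⟫ ≤ ⟪k, y0⟫ := fun y hy => hmax hy
  have hy0n := sph_norm (hCS hy0)
  have hm0 : 0 ≤ ⟪k, y0⟫ := (hsub hy0).2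
  have hm1 : ⟪k, y0⟫ < (1 : ℝ) := by
    refine lt_of_le_of_ne (inner_le_one' hkn hy0n) fun he => ?_
    have : k = y0 := (inner_eq_one_iff_of_norm_eq_one hkn hy0n).1 he
    have h2 := hdiam y0 hy0 t ht
    rw [← this, hkt] at h2
    linarith
  have hmpos : 0 < ⟪k, y0⟫ := by
    refine lt_of_le_of_ne hm0 fun he => ?_
    obtain ⟨z, hzS, ε, hε, hball⟩ := hint
    have hzn := sph_norm hzS
    have hzC : z ∈ C := hball ⟨mem_ball_self hε, hzS⟩
    have hkz : ⟪k, z⟫ = (0 : ℝ) := le_antisymm (by rw [he]; exact hmax' z hzC) (hsub hzC).2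
    have hzk : ⟪z, k⟫ = (0 : ℝ) := by rw [real_inner_comm]; exact hkz
    have hcont : Filter.Tendsto (fun τ : ℝ => Real.cos τ • z + Real.sin τ • k)
        (nhdsWithin 0 (Ioi 0)) (nhds z) := by
      have : Continuous (fun τ : ℝ => Real.cos τ • z + Real.sin τ • k) := by fun_prop
      have h2 := this.tendsto 0
      simp only [Real.cos_zero, Real.sin_zero, one_smul, zero_smul, add_zero] at h2
      exact h2.mono_left nhdsWithin_le_nhds
    have hev := hcont.eventually (ball_mem_nhds z hε)
    have hev2 : ∀ᶠ τ : ℝ in nhdsWithin 0 (Ioi 0), τ ∈ Ioo (0 : ℝ) Real.pi :=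
      Ioo_mem_nhdsGT Real.pi_pos
    obtain ⟨τ, hτ1, hτ2⟩ := (hev.and hev2).exists
    have hS : Real.cos τ • z + Real.sin τ • k ∈ Sph d := by
      apply sph_of_inner
      rw [inner_add_left, inner_add_right, inner_add_right]
      simp only [real_inner_smul_left, real_inner_smul_right, hkz, hzk, inner_self_one hzn,
        inner_self_one hkn]
      nlinarith [Real.sin_sq_add_cos_sq τ]
    have h3 := hmax' _ (hball ⟨hτ1, hS⟩)
    rw [← he, inner_add_right, real_inner_smul_right, real_inner_smul_right, hkz,
      inner_self_one hkn] at h3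
    have := Real.sin_pos_of_pos_of_lt_pi hτ2.1 hτ2.2
    linarith
  obtain ⟨k', hk'S, hsup, hk'y, hdec⟩ := support_of_max hCS hcv hkn hy0 hm0 hm1 hmax'
  refine ⟨y0, hy0, ?_⟩
  set m : ℝ := ⟪k, y0⟫ with hmdef
  have hpos : 0 < 1 - m ^ 2 := by nlinarith
  have hq2 : √(1 - m ^ 2) ^ 2 = 1 - m ^ 2 := Real.sq_sqrt hpos.le
  have hqpos : 0 < √(1 - m ^ 2) := Real.sqrt_pos.2 hpos
  set q := √(1 - m ^ 2) with hq
  have hk'n := sph_norm hk'S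
  have hkk' : ⟪k, k'⟫ = -q := by
    have hy0k' : ⟪y0, k'⟫ = (0 : ℝ) := by rw [real_inner_comm]; exact hk'y
    rw [hdec, inner_sub_left, real_inner_smul_left, real_inner_smul_left, inner_self_one hk'n,
      hy0k']
    ring
  have hle : width C k ≤ lthick k k' := by
    refine csInf_le (width_bdd C k) ⟨k', hk'S, ?_, ?_, hsup, rfl⟩
    · rintro rfl
      rw [inner_self_one hk'n] at hkk'
      linarith
    · rintro rfl
      rw [inner_neg_right, inner_self_one hkn] at hkk'
      nlinarith
  have hle2 : δ ≤ Real.arccos q := by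
    have := hw.trans hle
    simp only [lthick, sdist, hkk', Real.arccos_neg] at this
    linarith
  have hqc : q ≤ Real.cos δ := by
    have := Real.cos_le_cos_of_nonneg_of_le_pi h0.le (Real.arccos_le_pi q) hle2
    rwa [Real.cos_arccos (by linarith) (by nlinarith)] at this
  apply le_of_sq_le_sq _ hm0
  nlinarith

lemma complete_of_width {C : Set (E d)} (hC : IsBody C) {δ : ℝ} (h0 : 0 < δ)
    (h1 : δ < Real.pi / 2) (hd : sdiam C = δ)
    (hw : ∀ k ∈ Sph d, Supports k C → width C k = δ) : CompleteBody C δ := by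
  have hpi : δ ≤ Real.pi := by linarith [Real.pi_pos]
  have hc : 0 < Real.cos δ := Real.cos_pos_of_mem_Ioo ⟨by linarith, h1⟩
  have hs0 : 0 < Real.sin δ := Real.sin_pos_of_pos_of_lt_pi h0 (by linarith [Real.pi_pos])
  have hcs := Real.sin_sq_add_cos_sq δ
  have hCS := hC.1
  have hdiam := (sdiam_le_iff hCS h0.le hpi).1 hd.le
  have hcomp : IsCompact C := (isCompact_sphere (0 : E d) 1).of_isClosed_subset hC.2.1 hCS
  obtain ⟨z, hzS, ε, hε, hball⟩ := hC.2.2.2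
  have hzC : z ∈ C := hball ⟨mem_ball_self hε, hzS⟩
  refine ⟨⟨z, hzS, fun x hx => ⟨hCS hx, hc.le.trans (hdiam z hzC x hx)⟩⟩, hd, ?_⟩
  intro x hxS hxC
  by_contra hcon
  rw [not_lt, sdiam_le_iff (insert_subset hxS hCS) h0.le hpi] at hcon
  have hxd : ∀ y ∈ C, Real.cos δ ≤ ⟪x, y⟫ := fun y hy =>
    hcon x (mem_insert _ _) y (mem_insert_of_mem _ hy)
  have hxn := sph_norm hxS
  obtain ⟨t, ht, hmax⟩ := hcomp.exists_isMaxOn ⟨z, hzC⟩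
    (f := fun y => (⟪x, y⟫ : ℝ)) (by fun_prop)
  have htn := sph_norm (hCS ht)
  have hm0 : 0 < ⟪x, t⟫ := hc.trans_le (hxd t ht)
  have hm1 : ⟪x, t⟫ < (1 : ℝ) := by
    refine lt_of_le_of_ne (inner_le_one' hxn htn) fun he => hxC ?_
    rw [(inner_eq_one_iff_of_norm_eq_one hxn htn).1 he]; exact ht
  obtain ⟨k, hkS, hsup, hkt, hdec⟩ :=
    support_of_max hCS hC.2.2.1 hxn ht hm0.le hm1 (fun y hy => hmax hy)
  have hkn := sph_norm hkS
  obtain ⟨q, hq, hkq⟩ := deep_point hC h0 h1 hdiam hkS hsup (hw k hkS hsup).ge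
  have hb := bessel2 (sph_norm (hCS hq)) hkn htn hkt
  rw [real_inner_comm k q] at hb
  have hqt : ⟪q, t⟫ ≤ Real.cos δ := by
    apply le_of_sq_le_sq _ hc.le
    nlinarith
  have h3 := hxd q hq
  have hqpos : 0 ≤ √(1 - ⟪x, t⟫ ^ 2) := Real.sqrt_nonneg _
  set m : ℝ := ⟪x, t⟫ with hm
  rw [hdec, inner_sub_left, real_inner_smul_left, real_inner_smul_left, real_inner_comm q t] at h3
  have h4 : 0 ≤ √(1 - m ^ 2) * ⟪k, q⟫ := mul_nonneg hqpos (hs0.le.trans hkq)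
  nlinarith

/-- In a complete body, the point at distance `δ` along an inner normal belongs to the body. -/
lemma normal_point {C : Set (E d)} (hC : IsBody C) {δ : ℝ} (h0 : 0 < δ)
    (h1 : δ < Real.pi / 2) (hd : CompleteBody C δ) {k t : E d} (hkn : ‖k‖ = 1)
    (hsub : C ⊆ Hemi k) (ht : t ∈ C) (hkt : ⟪k, t⟫ = (0 : ℝ)) :
    Real.cos δ • t + Real.sin δ • k ∈ C := by
  have hpi : δ ≤ Real.pi := by linarith [Real.pi_pos]
  have hc : 0 < Real.cos δ := Real.cos_pos_of_mem_Ioo ⟨by linarith, h1⟩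
  have hs0 : 0 < Real.sin δ := Real.sin_pos_of_pos_of_lt_pi h0 (by linarith [Real.pi_pos])
  have hcs := Real.sin_sq_add_cos_sq δ
  have hCS := hC.1
  have hdiam := (sdiam_le_iff hCS h0.le hpi).1 hd.2.1.le
  have hcomp : IsCompact C := (isCompact_sphere (0 : E d) 1).of_isClosed_subset hC.2.1 hCS
  have htn := sph_norm (hCS ht)
  have htk : ⟪t, k⟫ = (0 : ℝ) := by rw [real_inner_comm]; exact hkt
  have hqS : Real.cos δ • t + Real.sin δ • k ∈ Sph d := by
    apply sph_of_inner
    rw [inner_add_left, inner_add_right, inner_add_right]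
    simp only [real_inner_smul_left, real_inner_smul_right, hkt, htk, inner_self_one htn,
      inner_self_one hkn]
    nlinarith
  refine complete_mem hCS h0.le hpi hd (sph_norm hqS) fun x hx => ?_
  by_contra hcon
  rw [not_le, inner_add_right, real_inner_smul_right, real_inner_smul_right] at hcon
  set c := Real.cos δ with hcdef
  set s := Real.sin δ with hsdef
  have hxk : 0 ≤ ⟪x, k⟫ := by rw [real_inner_comm]; exact (hsub hx).2
  obtain ⟨α, hα1, hα2⟩ : ∃ α, ⟪x, k⟫ < α ∧ α < c * (1 - ⟪x, t⟫) / s := by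
    apply exists_between
    rw [lt_div_iff₀ hs0]
    nlinarith
  rw [lt_div_iff₀ hs0] at hα2
  have hα0 : 0 < α := hxk.trans_lt hα1
  set w : E d := x - ⟪x, t⟫ • t - α • k with hwdef
  have hwt : ⟪t, w⟫ = (0 : ℝ) := by
    rw [hwdef, inner_sub_right, inner_sub_right, real_inner_smul_right, real_inner_smul_right,
      inner_self_one htn, htk, real_inner_comm x t]
    ring
  have hwk : ⟪k, w⟫ < (0 : ℝ) := by
    rw [hwdef, inner_sub_right, inner_sub_right, real_inner_smul_right, real_inner_smul_right,
      inner_self_one hkn, hkt, real_inner_comm x k]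
    linarith
  have hpw : ∀ p ∈ C, 0 < max (⟪p, w⟫ : ℝ) (⟪p, t⟫ - c) := by
    intro p hp
    rw [lt_max_iff]
    by_cases hpt : ⟪p, t⟫ = c
    · left
      have hb := bessel2 (sph_norm (hCS hp)) hkn htn hkt
      rw [hpt] at hb
      have hpk : ⟪p, k⟫ ≤ s := by
        apply le_of_sq_le_sq _ hs0.le
        linarith
      rw [hwdef, inner_sub_right, inner_sub_right, real_inner_smul_right, real_inner_smul_right,
        hpt]
      have := hdiam p hp x hx
      nlinarith [mul_le_mul_of_nonneg_left hpk hα0.le]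
    · right
      have := lt_of_le_of_ne (hdiam p hp t ht) (Ne.symm hpt)
      linarith
  obtain ⟨p0, hp0, hmin⟩ := hcomp.exists_isMinOn ⟨t, ht⟩
    (f := fun p => max (⟪p, w⟫ : ℝ) (⟪p, t⟫ - c)) (by fun_prop)
  set η := max (⟪p0, w⟫ : ℝ) (⟪p0, t⟫ - c) with hη
  have hη0 : 0 < η := hpw p0 hp0
  have hmin' : ∀ p ∈ C, η ≤ ⟪p, w⟫ ∨ η ≤ ⟪p, t⟫ - c := fun p hp => le_max_iff.1 (hmin hp)
  -- a small step
  have hev : ∀ᶠ ε : ℝ in nhdsWithin 0 (Ioi 0),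
      ε * (c * ‖w‖ ^ 2 / 2) < η ∧ ε * ‖w‖ + ε ^ 2 * (c * ‖w‖ ^ 2 / 2) < η := by
    apply Filter.Eventually.filter_mono nhdsWithin_le_nhds
    apply Filter.Eventually.and
    · have : Continuous fun ε : ℝ => ε * (c * ‖w‖ ^ 2 / 2) := by fun_prop
      exact this.tendsto 0 |>.eventually (gt_mem_nhds (by simpa using hη0))
    · have : Continuous fun ε : ℝ => ε * ‖w‖ + ε ^ 2 * (c * ‖w‖ ^ 2 / 2) := by fun_prop
      exact this.tendsto 0 |>.eventually (gt_mem_nhds (by simpa using hη0))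
  obtain ⟨ε, ⟨hε1, hε2⟩, hε0⟩ := (hev.and self_mem_nhdsWithin).exists
  have hε0 : 0 < ε := hε0
  have hN2 : ‖t + ε • w‖ ^ 2 = 1 + ε ^ 2 * ‖w‖ ^ 2 := by
    rw [norm_add_sq_real, real_inner_smul_right, hwt, htn, norm_smul, Real.norm_of_nonneg hε0.le]
    ring
  have hN0 : 0 < ‖t + ε • w‖ := by
    refine lt_of_le_of_ne (norm_nonneg _) fun he => ?_
    rw [← he] at hN2; nlinarith [sq_nonneg (ε * ‖w‖)]
  have hN1 : ‖t + ε • w‖ ≤ 1 + ε ^ 2 * ‖w‖ ^ 2 / 2 := by nlinarith [sq_nonneg (‖t + ε • w‖ - 1)]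
  have hyn : ‖‖t + ε • w‖⁻¹ • (t + ε • w)‖ = 1 := by
    rw [norm_smul, norm_inv, norm_norm, inv_mul_cancel₀ hN0.ne']
  have hyC : ‖t + ε • w‖⁻¹ • (t + ε • w) ∈ C := by
    refine complete_mem hCS h0.le hpi hd hyn fun p hp => ?_
    rw [real_inner_smul_right, ← div_eq_inv_mul, le_div_iff₀ hN0, ← hcdef]
    refine (mul_le_mul_of_nonneg_left hN1 hc.le).trans ?_
    rw [inner_add_right, real_inner_smul_right]
    have hpt := hdiam p hp t ht
    rcases hmin' p hp with h | h
    · have h5 := mul_le_mul_of_nonneg_left (hε1.le.trans h) hε0.le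
      nlinarith
    · have h6 := neg_le_of_abs_le (abs_real_inner_le_norm p w)
      rw [sph_norm (hCS hp), one_mul] at h6
      have h7 := mul_le_mul_of_nonneg_left h6 hε0.le
      nlinarith
  have h8 := (hsub hyC).2
  rw [real_inner_smul_right, inner_add_right, real_inner_smul_right, hkt, zero_add] at h8
  have h9 : ‖t + ε • w‖⁻¹ * (ε * ⟪k, w⟫) < 0 :=
    mul_neg_of_pos_of_neg (by positivity) (mul_neg_of_pos_of_neg hε0 hwk)
  linarith

lemma width_of_complete {C : Set (E d)} (hC : IsBody C) {δ : ℝ} (h0 : 0 < δ)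
    (h1 : δ < Real.pi / 2) (hd : CompleteBody C δ) {k : E d} (hk : k ∈ Sph d)
    (hsup : Supports k C) : width C k = δ := by
  have hpi : δ ≤ Real.pi := by linarith [Real.pi_pos]
  have hc : 0 < Real.cos δ := Real.cos_pos_of_mem_Ioo ⟨by linarith, h1⟩
  have hs0 : 0 < Real.sin δ := Real.sin_pos_of_pos_of_lt_pi h0 (by linarith [Real.pi_pos])
  have hcs := Real.sin_sq_add_cos_sq δ
  have hCS := hC.1
  have hdiam := (sdiam_le_iff hCS h0.le hpi).1 hd.2.1.le
  obtain ⟨hsub, t, ⟨_, hkt⟩, ht⟩ := hsup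
  have hkn := sph_norm hk
  have htn := sph_norm (hCS ht)
  have htk : ⟪t, k⟫ = (0 : ℝ) := by rw [real_inner_comm]; exact hkt
  have hq := normal_point hC h0 h1 hd hkn hsub ht hkt
  have harc : Real.arccos (-Real.cos δ) = Real.pi - δ := by
    rw [Real.arccos_neg, Real.arccos_cos h0.le hpi]
  set c := Real.cos δ with hcdef
  set s := Real.sin δ with hsdef
  have hmem : δ ∈ {w | ∃ k' ∈ Sph d, k' ≠ k ∧ k' ≠ -k ∧ Supports k' C ∧ w = lthick k k'} := by
    have hS : s • t - c • k ∈ Sph d := by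
      apply sph_of_inner
      rw [inner_sub_left, inner_sub_right, inner_sub_right]
      simp only [real_inner_smul_left, real_inner_smul_right, hkt, htk, inner_self_one htn,
        inner_self_one hkn]
      nlinarith
    have hkk : ⟪k, s • t - c • k⟫ = -c := by
      rw [inner_sub_right, real_inner_smul_right, real_inner_smul_right, hkt, inner_self_one hkn]
      ring
    refine ⟨s • t - c • k, hS, ?_, ?_, ⟨?_, c • t + s • k, ⟨hCS hq, ?_⟩, hq⟩, ?_⟩
    · intro he
      rw [he, inner_self_one hkn] at hkk; linarith
    · intro he
      rw [he, inner_neg_right, inner_self_one hkn] at hkk; nlinarith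
    · intro x hx
      refine ⟨hCS hx, ?_⟩
      have e1 := hdiam t ht x hx
      have e2 := inner_le_one' (sph_norm (hCS hq)) (sph_norm (hCS hx))
      rw [inner_add_left, real_inner_smul_left, real_inner_smul_left] at e2
      rw [inner_sub_left, real_inner_smul_left, real_inner_smul_left]
      have e3 : 0 ≤ s * (s * ⟪t, x⟫ - c * ⟪k, x⟫) := by
        have : s * (s * ⟪t, x⟫ - c * ⟪k, x⟫)
            = (s ^ 2 + c ^ 2) * ⟪t, x⟫ - c * (c * ⟪t, x⟫ + s * ⟪k, x⟫) := by ring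
        rw [this, hcs]
        nlinarith
      exact nonneg_of_mul_nonneg_right e3 hs0
    · rw [inner_sub_left, inner_add_right, inner_add_right]
      simp only [real_inner_smul_left, real_inner_smul_right, hkt, htk, inner_self_one htn,
        inner_self_one hkn]
      ring
    · simp only [lthick, sdist, hkk, harc]; ring
  apply le_antisymm
  · exact csInf_le (width_bdd C k) hmem
  · refine le_csInf ⟨δ, hmem⟩ ?_
    rintro w ⟨k', hk'S, _, _, ⟨hsub', _⟩, rfl⟩
    have hk'n := sph_norm hk'S
    have hge : -c ≤ ⟪k, k'⟫ := by
      rw [real_inner_comm]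
      by_contra hlt
      rw [not_le] at hlt
      have e1 := (hsub' hq).2
      have e2 := (hsub' ht).2
      have hb := bessel2 hk'n hkn htn hkt
      rw [inner_add_right, real_inner_smul_right, real_inner_smul_right] at e1
      have e3 : ⟪k', t⟫ < s := by
        apply lt_of_pow_lt_pow_left₀ 2 hs0.le
        nlinarith
      nlinarith
    have := Real.arccos_le_arccos hge
    rw [harc] at this
    simp only [lthick, sdist]; linarith

/-- a convex body of diameter `δ ∈ (0, π/2)` is complete iff it
is of constant width `δ`; moreover every complete set of diameter `δ` is the
intersection of all balls of radius `δ` centered at its points, hence a convex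
body. -/
theorem stmt19 (d : ℕ) (δ : ℝ) (h0 : 0 < δ) (h1 : δ < Real.pi / 2) :
    (∀ C : Set (E d), IsBody C → sdiam C = δ →
      (CompleteBody C δ ↔ ∀ k ∈ Sph d, Supports k C → width C k = δ)) ∧
    (∀ D : Set (E d), D ⊆ Sph d → CompleteBody D δ →
      D = {x ∈ Sph d | ∀ p ∈ D, sdist p x ≤ δ} ∧ IsBody D) := by
  exact ⟨fun C hC hd => ⟨fun h k hk hs => width_of_complete hC h0 h1 h hk hs,
    fun h => complete_of_width hC h0 h1 hd h⟩, fun D hD h => part2 hD h0 h1 h⟩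
end
end
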